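/- arXiv:2205.01949 — 3 statements merged into one kernel-verified Lean document; each statement's English description precedes it below -/
import Mathlib

section
/- Let N ≥ 1 be an integer and 0 = t_0 < t_1 < ⋯ < t_N a fixed time mesh with steps τ_k := t_k − t_{k−1}. For α ∈ (0,1) define the discrete L1 kernels a^{(n)}_{n−k}(α) := (1/τ_k) ∫_{t_{k−1}}^{t_k} (t_n − s)^{−α}/Γ(1−α) ds for 1 ≤ k ≤ n ≤ N. Then, as α → 1⁻, a^{(n)}_0(α) → 1/τ_n and a^{(n)}_{n−k}(α) → 0 for every 1 ≤ k ≤ n − 1. -/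
/-- The variable-step discrete L1 kernel: `L1kernel t α n k` is `a^{(n)}_{n−k}(α) =
(1/τ_k) ∫_{t_{k−1}}^{t_k} (t_n − s)^{−α}/Γ(1−α) ds`, the L1 approximation kernel of the
Caputo derivative of order `α` on the mesh `t`. -/
noncomputable def L1kernel (t : ℕ → ℝ) (α : ℝ) (n k : ℕ) : ℝ :=
  (1 / (t k - t (k - 1))) *
    ∫ s in (t (k - 1))..(t k), (t n - s) ^ (-α) / Real.Gamma (1 - α)

theorem L1aux_formula (t : ℕ → ℝ) (α : ℝ) (hα : α < 1) (n k : ℕ) :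
    L1kernel t α n k = (1 / (t k - t (k - 1))) *
      (((t n - t (k - 1)) ^ (1 - α) - (t n - t k) ^ (1 - α)) / Real.Gamma (2 - α)) := by
  unfold L1kernel
  congr 1
  rw [intervalIntegral.integral_div,
    intervalIntegral.integral_comp_sub_left (fun x => x ^ (-α)) (t n),
    integral_rpow (Or.inl (by linarith))]
  have h1 : (1 - α) ≠ 0 := by linarith
  have h2 : Real.Gamma (2 - α) = (1 - α) * Real.Gamma (1 - α) := by
    rw [← Real.Gamma_add_one h1]; congr 1; ring
  rw [h2, div_div, show -α + 1 = 1 - α by ring]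

theorem L1aux_gamma : Filter.Tendsto (fun α : ℝ => Real.Gamma (2 - α))
    (nhdsWithin 1 (Set.Iio 1)) (nhds 1) := by
  have h : ContinuousAt Real.Gamma (2 - 1) := by
    apply DifferentiableAt.continuousAt (𝕜 := ℝ)
    apply Real.differentiableAt_Gamma
    intro m
    have : (0 : ℝ) ≤ m := Nat.cast_nonneg m
    intro h
    linarith
  have h' : ContinuousAt (fun α : ℝ => Real.Gamma (2 - α)) 1 :=
    ContinuousAt.comp (g := Real.Gamma) (f := fun α : ℝ => 2 - α) h (by fun_prop)
  have := h'.tendsto.mono_left (nhdsWithin_le_nhds (s := Set.Iio 1))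
  rwa [show (2 : ℝ) - 1 = 1 by norm_num, Real.Gamma_one] at this

theorem L1aux_pow (c : ℝ) (hc : 0 < c) : Filter.Tendsto (fun α : ℝ => c ^ (1 - α))
    (nhdsWithin 1 (Set.Iio 1)) (nhds 1) := by
  have h' : ContinuousAt (fun α : ℝ => c ^ (1 - α)) 1 :=
    ContinuousAt.rpow continuousAt_const (by fun_prop) (Or.inl hc.ne')
  have := h'.tendsto.mono_left (nhdsWithin_le_nhds (s := Set.Iio 1))
  rwa [sub_self, Real.rpow_zero] at this

theorem L1aux_mono (N : ℕ) (t : ℕ → ℝ) (htlt : ∀ k, k < N → t k < t (k + 1)) (i j : ℕ)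
    (hij : i < j) (hj : j ≤ N) : t i < t j := by
  induction j, hij using Nat.le_induction with
  | base => exact htlt i hj
  | succ m hm ih => exact (ih (by omega)).trans (htlt m hj)

/-- On a fixed time mesh `0 = t₀ < t₁ < ⋯ < t_N`, as `α → 1⁻` the discrete
L1 kernels satisfy `a^{(n)}_0(α) → 1/τ_n` and `a^{(n)}_{n−k}(α) → 0` for `1 ≤ k ≤ n − 1`. -/
theorem L1_kernels_backward_Euler_limit
    (N : ℕ) (hN : 1 ≤ N) (t : ℕ → ℝ) (ht0 : t 0 = 0)
    (htlt : ∀ k, k < N → t k < t (k + 1)) :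
    ∀ n, 1 ≤ n → n ≤ N →
      Filter.Tendsto (fun α => L1kernel t α n n) (nhdsWithin 1 (Set.Iio 1))
        (nhds (1 / (t n - t (n - 1)))) ∧
      ∀ k, 1 ≤ k → k ≤ n - 1 →
        Filter.Tendsto (fun α => L1kernel t α n k) (nhdsWithin 1 (Set.Iio 1)) (nhds 0) := by
  intro n hn hnN
  have ev : ∀ k, (fun α => (1 / (t k - t (k - 1))) *
      (((t n - t (k - 1)) ^ (1 - α) - (t n - t k) ^ (1 - α)) / Real.Gamma (2 - α)))
      =ᶠ[nhdsWithin 1 (Set.Iio 1)] (fun α => L1kernel t α n k) := by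
    intro k
    filter_upwards [self_mem_nhdsWithin] with α hα
    exact (L1aux_formula t α hα n k).symm
  refine ⟨?_, ?_⟩
  · refine Filter.Tendsto.congr' (ev n) ?_
    have h0 : Filter.Tendsto (fun α : ℝ => (t n - t n) ^ (1 - α))
        (nhdsWithin 1 (Set.Iio 1)) (nhds 0) := by
      refine tendsto_const_nhds.congr' ?_
      filter_upwards [self_mem_nhdsWithin] with α hα
      have : (1 - α) ≠ 0 := (sub_pos.2 hα).ne'
      rw [sub_self, Real.zero_rpow this]
    have hp := L1aux_pow (t n - t (n - 1))
      (sub_pos.2 (L1aux_mono N t htlt _ _ (by omega) hnN))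
    simpa using ((hp.sub h0).div L1aux_gamma one_ne_zero).const_mul (1 / (t n - t (n - 1)))
  · intro k hk hkn
    refine Filter.Tendsto.congr' (ev k) ?_
    have hp := L1aux_pow (t n - t (k - 1))
      (sub_pos.2 (L1aux_mono N t htlt _ _ (by omega) hnN))
    have hq := L1aux_pow (t n - t k)
      (sub_pos.2 (L1aux_mono N t htlt _ _ (by omega) hnN))
    simpa using ((hp.sub hq).div L1aux_gamma one_ne_zero).const_mul (1 / (t k - t (k - 1)))
end

section
/- Let α ∈ (0,1), T > 0, C ≥ 0, and let g : [0,T] → ℝ be continuously differentiable. If the Caputo derivative satisfies (∂_t^α g)(t) = ∫_0^t ω_{1−α}(t − s) g'(s) ds ≤ C for every t ∈ (0,T], then g(t) ≤ g(0) + C·ω_{1+α}(t) = g(0) + C·t^α/Γ(1+α) for all t ∈ (0,T]. -/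
open MeasureTheory Set in
theorem beta_aux (α : ℝ) (hα : α ∈ Set.Ioo (0 : ℝ) 1) (s τ : ℝ) (h : s < τ) :
    ∫ t in s..τ, (τ - t) ^ (α - 1) * (t - s) ^ (-α) = Real.Gamma α * Real.Gamma (1 - α) := by
  have h1 := Complex.betaIntegral_scaled (α : ℂ) ((1 - α : ℝ) : ℂ) (sub_pos.2 h)
  have h2 := Complex.Gamma_mul_Gamma_eq_betaIntegral (s := (α : ℂ)) (t := ((1 - α : ℝ) : ℂ))
    (by simpa using hα.1) (by simpa using hα.2)
  have e1 : (α : ℂ) + ((1 - α : ℝ) : ℂ) = 1 := by push_cast; ring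
  rw [e1, Complex.Gamma_one, one_mul] at h2
  rw [e1, sub_self, Complex.cpow_zero, one_mul, ← h2, Complex.Gamma_ofReal,
    Complex.Gamma_ofReal] at h1
  have h3 : ∫ t in s..τ, (τ - t) ^ (α - 1) * (t - s) ^ (-α)
      = ∫ x in (0:ℝ)..(τ - s), x ^ (α - 1) * ((τ - s) - x) ^ (-α) := by
    have := intervalIntegral.integral_comp_sub_left (a := s) (b := τ)
      (fun x : ℝ => x ^ (α - 1) * ((τ - s) - x) ^ (-α)) τ
    simp only [sub_self] at this
    rw [← this]
    congr 1
    ext t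
    congr 2
    ring
  rw [h3]
  apply Complex.ofReal_injective
  rw [← intervalIntegral.integral_ofReal]
  push_cast
  rw [← h1]
  apply intervalIntegral.integral_congr
  intro x hx
  rw [uIcc_of_le (by linarith)] at hx
  simp only
  rw [Complex.ofReal_cpow hx.1, Complex.ofReal_cpow (by linarith [hx.2])]
  push_cast
  congr 2
  ring

open MeasureTheory Set in
theorem caputo_comparison_principle
    (α : ℝ) (hα : α ∈ Set.Ioo (0 : ℝ) 1) (T : ℝ) (hT : 0 < T) (C : ℝ) (hC : 0 ≤ C)
    (g g' : ℝ → ℝ)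
    (hg : ∀ s ∈ Set.Icc (0 : ℝ) T, HasDerivAt g (g' s) s)
    (hg' : ContinuousOn g' (Set.Icc (0 : ℝ) T))
    (hcaputo : ∀ τ ∈ Set.Ioc (0 : ℝ) T,
      (∫ s in (0 : ℝ)..τ, (τ - s) ^ (-α) / Real.Gamma (1 - α) * g' s) ≤ C) :
    ∀ τ ∈ Set.Ioc (0 : ℝ) T, g τ ≤ g 0 + C * (τ ^ α / Real.Gamma (1 + α)) := by
  intro τ hτ
  have hτ0 := hτ.1
  have hτT := hτ.2
  have hΓ1 : 0 < Real.Gamma α := Real.Gamma_pos_of_pos hα.1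
  have hΓ2 : 0 < Real.Gamma (1 - α) := Real.Gamma_pos_of_pos (by linarith [hα.2])
  set B := Real.Gamma α * Real.Gamma (1 - α) with hB
  have hB0 : 0 < B := by positivity
  have hsub : Icc 0 τ ⊆ Icc 0 T := Icc_subset_Icc_right hτT
  have hint : IntervalIntegrable g' volume 0 τ :=
    (hg'.mono (by rw [uIcc_of_le hτ0.le]; exact hsub)).intervalIntegrable
  have hftc : ∫ s in (0:ℝ)..τ, g' s = g τ - g 0 :=
    intervalIntegral.integral_eq_sub_of_hasDerivAt
      (fun s hs => hg s (hsub (by rwa [uIcc_of_le hτ0.le] at hs))) hint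
  have hIoo : IntegrableOn g' (Ioo 0 τ) := by
    rw [← integrableOn_Ioc_iff_integrableOn_Ioo]
    exact (intervalIntegrable_iff_integrableOn_Ioc_of_le hτ0.le).1 hint
  let G : ℝ → ℝ := (Ioo 0 τ).indicator g'
  have hG : Integrable G := hIoo.integrable_indicator measurableSet_Ioo
  let K : ℝ → ℝ → ℝ := fun s t =>
    (Ioo s τ).indicator (fun t => (τ - t) ^ (α - 1) * (t - s) ^ (-α)) t
  have hK0 : ∀ s t, 0 ≤ K s t := by
    intro s t
    apply indicator_nonneg
    intro t ht
    exact mul_nonneg (Real.rpow_nonneg (by linarith [ht.2]) _)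
      (Real.rpow_nonneg (by linarith [ht.1]) _)
  have hKm : Measurable (fun p : ℝ × ℝ => K p.1 p.2) := by
    have : (fun p : ℝ × ℝ => K p.1 p.2) = {p : ℝ × ℝ | p.1 < p.2 ∧ p.2 < τ}.indicator
        (fun p => (τ - p.2) ^ (α - 1) * (p.2 - p.1) ^ (-α)) := by
      ext p
      simp [K, indicator_apply]
    rw [this]
    apply Measurable.indicator
    · fun_prop
    · exact (measurableSet_lt measurable_fst measurable_snd).inter
        (measurableSet_lt measurable_snd measurable_const)
  have hKi : ∀ s, s < τ → ∫ t, K s t = B := by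
    intro s hs
    simp only [K]
    rw [integral_indicator measurableSet_Ioo, ← integral_Ioc_eq_integral_Ioo,
      ← intervalIntegral.integral_of_le hs.le, beta_aux α hα s τ hs]
  have hKint : ∀ s, s < τ → Integrable (K s) := by
    intro s hs
    by_contra hn
    have := hKi s hs
    rw [integral_undef hn] at this
    linarith
  let H : ℝ × ℝ → ℝ := fun p => G p.1 * K p.1 p.2
  have hGK : ∀ s, ∫ t, G s * K s t = G s * B := by
    intro s
    by_cases hs : s ∈ Ioo 0 τ
    · rw [integral_const_mul, hKi s hs.2]
    · simp [G, hs]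
  have hH : Integrable H (volume.prod volume) := by
    rw [integrable_prod_iff]
    · constructor
      · refine Filter.Eventually.of_forall fun s => ?_
        by_cases hs : s ∈ Ioo 0 τ
        · exact (hKint s hs.2).const_mul (G s)
        · simp [H, G, hs]
      · have : (fun s => ∫ t, ‖H (s, t)‖) = fun s => ‖G s‖ * B := by
          ext s
          simp only [H, norm_mul, Real.norm_of_nonneg (hK0 _ _)]
          by_cases hs : s ∈ Ioo 0 τ
          · rw [integral_const_mul, hKi s hs.2]
          · simp [G, hs]
        rw [this]
        exact hG.norm.mul_const _
    · exact hG.aestronglyMeasurable.comp_fst.mul hKm.aestronglyMeasurable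
  have hsw : ∫ s, ∫ t, H (s, t) = ∫ t, ∫ s, H (s, t) := integral_integral_swap hH
  have hL : ∫ s, ∫ t, H (s, t) = (g τ - g 0) * B := by
    simp only [H, hGK]
    rw [integral_mul_const, ← hftc, intervalIntegral.integral_of_le hτ0.le,
      integral_Ioc_eq_integral_Ioo, integral_indicator measurableSet_Ioo]
  have hpow : IntervalIntegrable (fun t => (τ - t) ^ (α - 1)) volume 0 τ := by
    have := (intervalIntegral.intervalIntegrable_rpow' (a := 0) (b := τ) (r := α - 1)
      (by linarith [hα.1])).comp_sub_left τ
    simpa using this.symm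
  have hpowv : ∫ t in (0:ℝ)..τ, (τ - t) ^ (α - 1) = τ ^ α / α := by
    rw [intervalIntegral.integral_comp_sub_left (fun x : ℝ => x ^ (α - 1)) τ,
      integral_rpow (Or.inl (by linarith [hα.1]))]
    simp [hα.1.ne']
  have hR : ∫ t, ∫ s, H (s, t) ≤
      ∫ t, (Ioo 0 τ).indicator (fun t => (τ - t) ^ (α - 1) * (Real.Gamma (1 - α) * C)) t := by
    apply integral_mono
    · exact hH.integral_prod_right
    · refine IntegrableOn.integrable_indicator ?_ measurableSet_Ioo
      rw [← integrableOn_Ioc_iff_integrableOn_Ioo]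
      exact ((intervalIntegrable_iff_integrableOn_Ioc_of_le hτ0.le).1 hpow).mul_const _
    · intro t
      by_cases ht : t ∈ Ioo 0 τ
      · have hc := hcaputo t ⟨ht.1, ht.2.le.trans hτT⟩
        have e : ∀ s, H (s, t) = (τ - t) ^ (α - 1) * (Real.Gamma (1 - α) *
            (Ioo 0 t).indicator (fun s => (t - s) ^ (-α) / Real.Gamma (1 - α) * g' s) s) := by
          intro s
          by_cases hs : s ∈ Ioo 0 t
          · have h1 : s ∈ Ioo 0 τ := ⟨hs.1, hs.2.trans ht.2⟩
            have h2 : t ∈ Ioo s τ := ⟨hs.2, ht.2⟩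
            simp only [H, G, K, indicator_of_mem h1, indicator_of_mem h2, indicator_of_mem hs]
            field_simp
          · rw [indicator_of_notMem hs]
            by_cases h1 : s ∈ Ioo 0 τ
            · have h2 : t ∉ Ioo s τ := fun h => hs ⟨h1.1, h.1⟩
              simp [H, K, indicator_of_notMem h2]
            · simp [H, G, indicator_of_notMem h1]
        simp only [e, indicator_of_mem ht]
        rw [integral_const_mul, integral_const_mul, integral_indicator measurableSet_Ioo,
          ← integral_Ioc_eq_integral_Ioo, ← intervalIntegral.integral_of_le ht.1.le]
        have : 0 ≤ (τ - t) ^ (α - 1) := Real.rpow_nonneg (by linarith [ht.2]) _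
        gcongr
      · have e : ∀ s, H (s, t) = 0 := by
          intro s
          by_cases h1 : s ∈ Ioo 0 τ
          · have h2 : t ∉ Ioo s τ := fun h => ht ⟨h1.1.trans h.1, h.2⟩
            simp [H, K, indicator_of_notMem h2]
          · simp [H, G, indicator_of_notMem h1]
        simp [e, indicator_of_notMem ht]
  rw [integral_indicator measurableSet_Ioo, ← integral_Ioc_eq_integral_Ioo,
      ← intervalIntegral.integral_of_le hτ0.le, intervalIntegral.integral_mul_const, hpowv,
      ← hsw, hL] at hR
  rw [add_comm 1 α, Real.Gamma_add_one hα.1.ne']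
  have hfin : (g τ - g 0) ≤ C * (τ ^ α / (α * Real.Gamma α)) := by
    have hα0 := hα.1
    refine le_of_mul_le_mul_right (hR.trans_eq ?_) hB0
    rw [hB]
    field_simp
  linarith
end

section
/- Let H be a real Hilbert space, α ∈ (0,1), T > 0, and let u : [0,T] → H be continuously differentiable. Then for every t ∈ (0,T], ⟨∫_0^t ω_{1−α}(t − s) u'(s) ds, u(t)⟩ ≥ (1/2) ∫_0^t ω_{1−α}(t − s) (d/ds)‖u(s)‖² ds; equivalently, ⟨(∂_t^α u)(t), u(t)⟩ ≥ (1/2)(∂_t^α ‖u‖²)(t), where ∂_t^α denotes the Caputo derivative of order α. -/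
open RealInnerProductSpace

/-- Alikhanov-type estimate: for a continuously differentiable `u : [0,T] → H`
into a real Hilbert space and `α ∈ (0,1)`, for every `t ∈ (0,T]`,
`⟨∫_0^t ω_{1−α}(t − s) u'(s) ds, u(t)⟩ ≥ (1/2) ∫_0^t ω_{1−α}(t − s) (d/ds)‖u(s)‖² ds`,
i.e. `⟨(∂_t^α u)(t), u(t)⟩ ≥ (1/2)(∂_t^α ‖u‖²)(t)` for the Caputo derivative of order `α`,
where `ω_{1−α}(r) = r^{−α}/Γ(1−α)`. -/
theorem caputo_inner_product_lower_bound {H : Type*} [NormedAddCommGroup H]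
    [InnerProductSpace ℝ H] [CompleteSpace H]
    (α T : ℝ) (hα : α ∈ Set.Ioo (0 : ℝ) 1) (hT : 0 < T)
    (u u' : ℝ → H)
    (hu : ∀ s ∈ Set.Icc (0 : ℝ) T, HasDerivAt u (u' s) s)
    (hu' : ContinuousOn u' (Set.Icc (0 : ℝ) T)) :
    ∀ τ ∈ Set.Ioc (0 : ℝ) T,
      (1 / 2) * ∫ s in (0 : ℝ)..τ,
          (τ - s) ^ (-α) / Real.Gamma (1 - α) * deriv (fun r => ‖u r‖ ^ 2) s ≤
        ⟪∫ s in (0 : ℝ)..τ, ((τ - s) ^ (-α) / Real.Gamma (1 - α)) • u' s, u τ⟫ := by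
  intro τ hτ
  obtain ⟨hα0, hα1⟩ := hα
  obtain ⟨hτ0, hτT⟩ := hτ
  have hsub : Set.Icc (0:ℝ) τ ⊆ Set.Icc 0 T := Set.Icc_subset_Icc le_rfl hτT
  have hG : 0 < Real.Gamma (1 - α) := Real.Gamma_pos_of_pos (by linarith)
  set G := Real.Gamma (1 - α) with hGdef
  have huc : ContinuousOn u (Set.uIcc 0 τ) := by
    rw [Set.uIcc_of_le hτ0.le]
    exact fun s hs => (hu s (hsub hs)).continuousAt.continuousWithinAt
  have hu'c : ContinuousOn u' (Set.uIcc 0 τ) := by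
    rw [Set.uIcc_of_le hτ0.le]; exact hu'.mono hsub
  have hk : IntervalIntegrable (fun s => (τ - s) ^ (-α) / G) MeasureTheory.volume 0 τ := by
    have h := (intervalIntegral.intervalIntegrable_rpow' (r := -α) (a := τ) (b := 0)
      (by linarith)).comp_sub_left τ
    simp only [sub_self, sub_zero] at h
    exact h.div_const G
  have hku : IntervalIntegrable (fun s => ((τ - s) ^ (-α) / G) • u' s) MeasureTheory.volume 0 τ :=
    hk.smul_continuousOn hu'c
  have hkc : ∀ f : ℝ → ℝ, ContinuousOn f (Set.uIcc 0 τ) →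
      IntervalIntegrable (fun s => ((τ - s) ^ (-α) / G) * f s) MeasureTheory.volume 0 τ :=
    fun f hf => hk.mul_continuousOn hf
  have e1 : ⟪∫ s in (0 : ℝ)..τ, ((τ - s) ^ (-α) / G) • u' s, u τ⟫
      = ∫ s in (0 : ℝ)..τ, ((τ - s) ^ (-α) / G) * ⟪u τ, u' s⟫ := by
    rw [real_inner_comm]
    have := (innerSL ℝ (u τ)).intervalIntegral_comp_comm hku
    simp only [innerSL_apply_apply, inner_smul_right] at this
    exact this.symm
  have e2 : (1 / 2) * ∫ s in (0 : ℝ)..τ, (τ - s) ^ (-α) / G * deriv (fun r => ‖u r‖ ^ 2) s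
      = ∫ s in (0 : ℝ)..τ, ((τ - s) ^ (-α) / G) * ⟪u s, u' s⟫ := by
    rw [← intervalIntegral.integral_const_mul]
    apply intervalIntegral.integral_congr
    intro s hs
    rw [Set.uIcc_of_le hτ0.le] at hs
    have := ((hu s (hsub hs)).norm_sq).deriv
    simp only [this]
    ring
  rw [e1, e2]
  have c1 : ContinuousOn (fun s => ⟪u τ, u' s⟫) (Set.uIcc 0 τ) := continuousOn_const.inner hu'c
  have c2 : ContinuousOn (fun s => ⟪u s, u' s⟫) (Set.uIcc 0 τ) := huc.inner hu'c
  rw [← sub_nonpos, ← intervalIntegral.integral_sub (hkc _ c2) (hkc _ c1)]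
  -- the primitive
  let F : ℝ → ℝ := fun s => ((τ - s) ^ (-α) / G) * (‖u s - u τ‖ ^ 2 / 2)
  have hFτ : F τ = 0 := by simp [F]
  have hF0 : 0 ≤ F 0 := by
    have : 0 ≤ (τ - 0) ^ (-α) := Real.rpow_nonneg (by linarith) _
    positivity
  have hd : ∀ s ∈ Set.Ioo 0 τ, HasDerivAt F
      (((τ - s) ^ (-α) / G) * ⟪u s - u τ, u' s⟫
        + (α * (τ - s) ^ (-α - 1) / G) * (‖u s - u τ‖ ^ 2 / 2)) s := by
    intro s hs
    have h1 := ((hu s (hsub ⟨hs.1.le, hs.2.le⟩)).sub_const (u τ)).norm_sq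
    have h2 : HasDerivAt (fun s => (τ - s) ^ (-α)) _ s :=
      ((hasDerivAt_id s).const_sub τ).rpow_const (p := -α)
      (Or.inl (by simp only [id]; linarith [hs.2]))
    refine HasDerivAt.congr_deriv (f := F) ((h2.div_const G).mul (h1.div_const 2)) ?_
    simp only [id]
    ring
  have hFc : ContinuousOn F (Set.Icc 0 τ) := by
    intro s hs
    rcases hs.2.lt_or_eq with h | h
    · have h2 : ContinuousAt (fun s => (τ - s) ^ (-α)) s :=
        (continuousAt_const.sub continuousAt_id).rpow_const
          (Or.inl (show τ - s ≠ 0 by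
            intro h0
            linarith))
      have h1 := (hu s (hsub hs)).continuousAt
      exact ((h2.div_const G).mul
        (((h1.sub continuousAt_const).norm.pow 2).div_const 2)).continuousWithinAt
    · subst h
      unfold ContinuousWithinAt
      rw [hFτ]
      obtain ⟨C, hC⟩ := (hu s (hsub hs)).isBigO_sub.bound
      have hlim : Filter.Tendsto (fun x => C ^ 2 / (2 * G) * (s - x) ^ (2 - α))
          (nhdsWithin s (Set.Icc 0 s)) (nhds 0) := by
        have : Continuous (fun x => C ^ 2 / (2 * G) * (s - x) ^ (2 - α)) :=
          continuous_const.mul ((continuous_const.sub continuous_id).rpow_const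
            (fun _ => Or.inr (by linarith)))
        have h := this.tendsto s
        simp only [sub_self] at h
        rw [Real.zero_rpow (by linarith), mul_zero] at h
        exact h.mono_left nhdsWithin_le_nhds
      refine squeeze_zero' ?_ ?_ hlim
      · filter_upwards [self_mem_nhdsWithin] with x hx
        have : 0 ≤ (s - x) ^ (-α) := Real.rpow_nonneg (by linarith [hx.2]) _
        positivity
      · filter_upwards [self_mem_nhdsWithin, nhdsWithin_le_nhds hC] with x hx hxC
        rcases hx.2.lt_or_eq with h | h
        · have hp : 0 < s - x := by linarith
          have : 0 ≤ (s - x) ^ (-α) := Real.rpow_nonneg hp.le _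
          have e : (s - x) ^ (2 - α) = (s - x) ^ (-α) * (s - x) ^ 2 := by
            rw [← Real.rpow_natCast, ← Real.rpow_add hp]
            congr 1; push_cast; ring
          have hsq : ‖u x - u s‖ ^ 2 ≤ (C * ‖x - s‖) ^ 2 :=
            pow_le_pow_left₀ (norm_nonneg _) hxC 2
          rw [mul_pow, Real.norm_eq_abs, sq_abs] at hsq
          rw [e]
          calc F x ≤ ((s - x) ^ (-α) / G) * (C ^ 2 * (x - s) ^ 2 / 2) := by
                simp only [F]; gcongr
            _ = _ := by field_simp; ring
        · subst h
          rw [hFτ]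
          simp [Real.zero_rpow (show (2 - α) ≠ 0 by linarith)]
  have key := intervalIntegral.integral_le_sub_of_hasDeriv_right_of_le hτ0.le hFc
    (fun s hs => (hd s hs).hasDerivWithinAt)
    (φ := fun s => ((τ - s) ^ (-α) / G) * ⟪u s, u' s⟫ - ((τ - s) ^ (-α) / G) * ⟪u τ, u' s⟫)
    (by
      rw [← intervalIntegrable_iff_integrableOn_Icc_of_le hτ0.le]
      exact (hkc _ c2).sub (hkc _ c1))
    (by
      intro s hs
      have : 0 ≤ (τ - s) ^ (-α - 1) := Real.rpow_nonneg (by linarith [hs.2]) _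
      rw [inner_sub_left, mul_sub]
      have : 0 ≤ (α * (τ - s) ^ (-α - 1) / G) * (‖u s - u τ‖ ^ 2 / 2) := by positivity
      linarith)
  linarith
end
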